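/- For every independent set S of G there exists a solution to Disjoint A,B-paths on the instance I of length 12|V| + 3|E| − |S|. Moreover, for every maximum independent set S of G, the number of solutions of length 12|V| + 3|E| − α(G) in which, for each v ∈ V, the vertices v′₁ and v′₈ are joined by the path v′₁v′₂⋯v′₈ precisely when v ∈ S, equals 2^{|E| − 3α(G)}. -/

import Mathlib

/-- `f` is a family of `(|A|+|B|)/2` pairwise vertex-disjoint simple paths of `G`,
each with both endpoints in `A` or both endpoints in `B`, such that every vertex of
`A ∪ B` is an endpoint of one of the paths, and `E'` is the union of their edge
sets.  This witnesses that `E'` is a solution to Disjoint `A`,`B`-paths. -/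
def IsPathFamily {V : Type} [DecidableEq V] (G : SimpleGraph V) (A B : Finset V)
    (E' : Set (Sym2 V)) {k : ℕ} (f : Fin k → (u : V) × (v : V) × G.Walk u v) : Prop :=
  k = (A.card + B.card) / 2 ∧
  (∀ i, (f i).2.2.IsPath) ∧
  (∀ i, ((f i).1 ∈ A ∧ (f i).2.1 ∈ A) ∨ ((f i).1 ∈ B ∧ (f i).2.1 ∈ B)) ∧
  (∀ i j, i ≠ j → ∀ x, x ∈ (f i).2.2.support → x ∉ (f j).2.2.support) ∧
  (∀ z, z ∈ A ∪ B → ∃ i, z = (f i).1 ∨ z = (f i).2.1) ∧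
  E' = ⋃ i, {e | e ∈ (f i).2.2.edges}

/-- `E'` is a solution to Disjoint `A`,`B`-paths on `G`. -/
def IsSolution {V : Type} [DecidableEq V] (G : SimpleGraph V) (A B : Finset V)
    (E' : Set (Sym2 V)) : Prop :=
  ∃ (k : ℕ) (f : Fin k → (u : V) × (v : V) × G.Walk u v), IsPathFamily G A B E' f

/-- The length of an edge set: the sum of the lengths of its edges. -/
noncomputable def lengthOf {V : Type} (ℓ : Sym2 V → ℕ) (E' : Set (Sym2 V)) : ℕ :=
  ∑ᶠ e ∈ E', ℓ e

/-- `ℓ_{A,B}`: the minimum length of a solution to Disjoint `A`,`B`-paths. -/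
noncomputable def lAB {V : Type} [DecidableEq V] (G : SimpleGraph V) (A B : Finset V)
    (ℓ : Sym2 V → ℕ) : ℕ :=
  sInf {n | ∃ E', IsSolution G A B E' ∧ lengthOf ℓ E' = n}

/-- `S_{A,B}`: the number of minimum-length solutions to Disjoint `A`,`B`-paths. -/
noncomputable def nSol {V : Type} [DecidableEq V] (G : SimpleGraph V) (A B : Finset V)
    (ℓ : Sym2 V → ℕ) : ℕ :=
  Set.ncard {E' | IsSolution G A B E' ∧ lengthOf ℓ E' = lAB G A B ℓ}


/-- Vertex type of the instance `I`: `Sum.inl (v, i)` is the gadget-cycle vertex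
`v′_{i+1}` (for `v ∈ V`, `i : Fin 8`), and `Sum.inr (e, k)` is the edge-gadget
vertex `w′_{k+1}(e)` (used only for edges `e` of `G`). -/
abbrev IVert (V : Type) : Type := (V × Fin 8) ⊕ (Sym2 V × Fin 2)

/-- Base relation of the instance `I`: for each vertex `v` of `G` an 8-cycle
`v′₁ … v′₈`, and for each edge `e = uv` of `G` (with `fs e = u`, `sn e = v`) the four
edges `w′₁(e)u′_{σ_u(e)}`, `w′₂(e)u′_{σ_u(e)+1}`, `w′₁(e)v′_{σ_v(e)+1}`,
`w′₂(e)v′_{σ_v(e)}` (in the `Fin 8`-indexing, `v′_m` is `Sum.inl (v, m-1)`). -/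
def iRel {V : Type} (G : SimpleGraph V) (σ : V → Sym2 V → ℕ) (fs sn : Sym2 V → V) :
    IVert V → IVert V → Prop
  | .inl (v, i), .inl (w, j) =>
      v = w ∧ (i.val + 1 = j.val ∨ (i.val = 7 ∧ j.val = 0))
  | .inr (e, k), .inl (w, i) => e ∈ G.edgeSet ∧
      ((k = 0 ∧ w = fs e ∧ i.val + 1 = σ w e) ∨
       (k = 1 ∧ w = fs e ∧ i.val = σ w e) ∨
       (k = 0 ∧ w = sn e ∧ i.val = σ w e) ∨
       (k = 1 ∧ w = sn e ∧ i.val + 1 = σ w e))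
  | _, _ => False

/-- The graph of the instance `I`. -/
def instGraph {V : Type} (G : SimpleGraph V) (σ : V → Sym2 V → ℕ)
    (fs sn : Sym2 V → V) : SimpleGraph (IVert V) :=
  SimpleGraph.fromRel (iRel G σ fs sn)

open Classical in
/-- Edge lengths of the instance `I`: the cycle edge `v′₈v′₁` has length `12`, the
cycle edges `v′ᵢv′ᵢ₊₁` with `i` odd (`Fin`-index even) have length `2`, and all other
edges have length `1`. -/
noncomputable def instLen {V : Type} : Sym2 (IVert V) → ℕ := fun ε =>
  if ∃ v : V, ε = s((Sum.inl (v, (7 : Fin 8)) : IVert V), Sum.inl (v, (0 : Fin 8)))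
  then 12
  else if ∃ (v : V) (i j : Fin 8), i.val % 2 = 0 ∧ i.val + 1 = j.val ∧
      ε = s((Sum.inl (v, i) : IVert V), Sum.inl (v, j))
  then 2
  else 1

/-- The terminal set `A` of the instance `I`: the vertices `v′₁` and `v′₈`, `v ∈ V`. -/
def instA (V : Type) [Fintype V] [DecidableEq V] : Finset (IVert V) :=
  Finset.univ.image (fun v : V => (Sum.inl (v, (0 : Fin 8)) : IVert V)) ∪
    Finset.univ.image (fun v : V => (Sum.inl (v, (7 : Fin 8)) : IVert V))

/-- The terminal set `B` of the instance `I`: the vertices `w′₁(e)` and `w′₂(e)`,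
`e ∈ E`. -/
def instB {V : Type} [Fintype V] [DecidableEq V] (G : SimpleGraph V)
    [DecidableRel G.Adj] : Finset (IVert V) :=
  G.edgeFinset.image (fun e => (Sum.inr (e, (0 : Fin 2)) : IVert V)) ∪
    G.edgeFinset.image (fun e => (Sum.inr (e, (1 : Fin 2)) : IVert V))

/-- The independence number `α(G)`. -/
noncomputable def indepNum {V : Type} (G : SimpleGraph V) : ℕ :=
  sSup {n | ∃ S : Finset V, (∀ u ∈ S, ∀ w ∈ S, ¬ G.Adj u w) ∧ S.card = n}

/-- The edge set of the long path `v′₁v′₂⋯v′₈` (of length 11) around the gadget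
cycle of `v`. -/
def longPathEdges {V : Type} (v : V) : Set (Sym2 (IVert V)) :=
  {ε | ∃ j : Fin 8, j.val < 7 ∧ ε = s((Sum.inl (v, j) : IVert V), Sum.inl (v, j + 1))}

section PathFamily

variable {V : Type} {G : SimpleGraph V}

lemma lengthOf_edges (ℓ : Sym2 V → ℕ) {u v : V} {p : G.Walk u v} (hp : p.IsPath) :
    lengthOf ℓ {e | e ∈ p.edges} = (p.edges.map ℓ).sum := by
  classical
  have h : {e | e ∈ p.edges} = (p.edges.toFinset : Set (Sym2 V)) := by ext; simp
  rw [lengthOf, h, finsum_mem_coe_finset, List.sum_toFinset _ hp.isTrail.edges_nodup]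

variable [DecidableEq V] {A B : Finset V} {E' : Set (Sym2 V)}

lemma IsPathFamily.lengthOf_eq {k : ℕ} {f : Fin k → (u : V) × (v : V) × G.Walk u v}
    (hf : IsPathFamily G A B E' f) (ℓ : Sym2 V → ℕ) :
    lengthOf ℓ E' = ∑ i, lengthOf ℓ {e | e ∈ (f i).2.2.edges} := by
  obtain ⟨-, -, -, hdis, -, rfl⟩ := hf
  rw [← finsum_eq_sum_of_fintype]
  refine finsum_mem_iUnion (fun i j hij => ?_) fun i => List.finite_toSet _
  refine Set.disjoint_left.2 fun e => ?_
  induction e with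
  | _ x y =>
    intro hi hj
    exact hdis i j hij x (SimpleGraph.Walk.fst_mem_support_of_mem_edges _ hi)
      (SimpleGraph.Walk.fst_mem_support_of_mem_edges _ hj)

lemma IsPathFamily.eq_endpoint {k : ℕ} {f : Fin k → (u : V) × (v : V) × G.Walk u v}
    (hf : IsPathFamily G A B E' f) {i : Fin k} {x : V} (hx : x ∈ (f i).2.2.support)
    (hxT : x ∈ A ∪ B) : x = (f i).1 ∨ x = (f i).2.1 := by
  obtain ⟨-, -, -, hdis, hcov, -⟩ := hf
  obtain ⟨j, hj⟩ := hcov x hxT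
  rcases eq_or_ne i j with rfl | hij
  · exact hj
  · refine absurd ?_ (hdis i j hij x hx)
    rcases hj with rfl | rfl
    · exact SimpleGraph.Walk.start_mem_support _
    · exact SimpleGraph.Walk.end_mem_support _

lemma IsPathFamily.index_unique {k : ℕ} {f : Fin k → (u : V) × (v : V) × G.Walk u v}
    (hf : IsPathFamily G A B E' f) {i j : Fin k} {x : V} (hi : x ∈ (f i).2.2.support)
    (hj : x ∈ (f j).2.2.support) : i = j := by
  by_contra hij
  exact hf.2.2.2.1 i j hij x hi hj

lemma IsPathFamily.endpoints_ne {k : ℕ} {f : Fin k → (u : V) × (v : V) × G.Walk u v}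
    (hf : IsPathFamily G A B E' f) (hk : 2 * k = A.card + B.card) (hAB : Disjoint A B)
    (i : Fin k) : (f i).1 ≠ (f i).2.1 := by
  intro h
  have hsub : A ∪ B ⊆ Finset.univ.image (fun i => (f i).1) ∪
      (Finset.univ.erase i).image (fun i => (f i).2.1) := by
    intro z hz
    obtain ⟨j, hj⟩ := hf.2.2.2.2.1 z hz
    simp only [Finset.mem_union, Finset.mem_image, Finset.mem_univ, true_and,
      Finset.mem_erase, and_true]
    rcases hj with rfl | rfl
    · exact Or.inl ⟨j, rfl⟩
    · rcases eq_or_ne j i with rfl | hji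
      · exact Or.inl ⟨j, h⟩
      · exact Or.inr ⟨j, hji, rfl⟩
  have h1 := Finset.card_le_card hsub
  have h2 := Finset.card_union_le (Finset.univ.image (fun i => (f i).1))
    ((Finset.univ.erase i).image (fun i => (f i).2.1))
  have h3 : (Finset.univ.image (fun i => (f i).1)).card ≤ k :=
    Finset.card_image_le.trans (by simp)
  have h4 : ((Finset.univ.erase i).image (fun i => (f i).2.1)).card ≤ k - 1 :=
    Finset.card_image_le.trans (by simp)
  rw [Finset.card_union_of_disjoint hAB] at h1
  have := i.pos
  omega

lemma IsPathFamily.exists_path_from {k : ℕ} {f : Fin k → (u : V) × (v : V) × G.Walk u v}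
    (hf : IsPathFamily G A B E' f) (hk : 2 * k = A.card + B.card) (hAB : Disjoint A B) {z : V}
    (hz : z ∈ A ∪ B) :
    ∃ (i : Fin k) (b : V) (p : G.Walk z b), p.IsPath ∧ z ≠ b ∧
      ((z ∈ A ∧ b ∈ A) ∨ (z ∈ B ∧ b ∈ B)) ∧
      (∀ x, x ∈ p.support ↔ x ∈ (f i).2.2.support) ∧
      {ε | ε ∈ p.edges} = {ε | ε ∈ (f i).2.2.edges} ∧
      ∀ x ∈ p.support, x ∈ A ∪ B → x = z ∨ x = b := by
  obtain ⟨i, hi⟩ := hf.2.2.2.2.1 z hz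
  have hne := hf.endpoints_ne hk hAB i
  have hpath := hf.2.1 i
  have hend := hf.2.2.1 i
  have hT := fun x => hf.eq_endpoint (i := i) (x := x)
  refine ⟨i, ?_⟩
  generalize f i = t at *
  obtain ⟨a, b, p⟩ := t
  rcases hi with rfl | rfl
  · exact ⟨b, p, hpath, hne, hend, fun x => Iff.rfl, rfl, fun x => hT x⟩
  · refine ⟨a, p.reverse, hpath.reverse, hne.symm, hend.imp And.symm And.symm, by simp, by simp,
      fun x hx hxT => (hT x (by simpa using hx) hxT).symm⟩

lemma isPathFamily_comp_equiv {k : ℕ} {ι : Type} (e : Fin k ≃ ι)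
    (f : ι → (u : V) × (v : V) × G.Walk u v) (hk : k = (A.card + B.card) / 2)
    (hpath : ∀ i, (f i).2.2.IsPath)
    (hend : ∀ i, ((f i).1 ∈ A ∧ (f i).2.1 ∈ A) ∨ ((f i).1 ∈ B ∧ (f i).2.1 ∈ B))
    (hdis : ∀ i j x, x ∈ (f i).2.2.support → x ∈ (f j).2.2.support → i = j)
    (hcov : ∀ z, z ∈ A ∪ B → ∃ i, z = (f i).1 ∨ z = (f i).2.1) :
    IsPathFamily G A B (⋃ i, {e | e ∈ (f i).2.2.edges}) (f ∘ e) := by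
  refine ⟨hk, fun i => hpath _, fun i => hend _,
    fun i j hij x hi hj => hij (e.injective (hdis _ _ x hi hj)), fun z hz => ?_, ?_⟩
  · obtain ⟨i, hi⟩ := hcov z hz
    obtain ⟨j, rfl⟩ := e.surjective i
    exact ⟨j, hi⟩
  · exact (e.surjective.iUnion_comp fun i => {e | e ∈ (f i).2.2.edges}).symm

end PathFamily

section Instance

variable {V : Type} {G : SimpleGraph V} {σ : V → Sym2 V → ℕ} {fs sn : Sym2 V → V}

/-- The conditions on the data `σ`, `fs`, `sn` used to build the instance `I` from `G`. -/
structure IsAdmissible (G : SimpleGraph V) (σ : V → Sym2 V → ℕ) (fs sn : Sym2 V → V) :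
    Prop where
  eq_mk : ∀ e ∈ G.edgeSet, e = s(fs e, sn e)
  mem : ∀ v : V, ∀ e ∈ G.incidenceSet v, σ v e = 2 ∨ σ v e = 4 ∨ σ v e = 6
  inj : ∀ v : V, Set.InjOn (σ v) (G.incidenceSet v)

namespace IsAdmissible

lemma fs_ne_sn (h : IsAdmissible G σ fs sn) {e : Sym2 V} (he : e ∈ G.edgeSet) :
    fs e ≠ sn e := by
  have h1 := he
  rw [h.eq_mk e he] at h1
  exact G.ne_of_adj h1

lemma mem_iff (h : IsAdmissible G σ fs sn) {e : Sym2 V} (he : e ∈ G.edgeSet) {u : V} :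
    u ∈ e ↔ u = fs e ∨ u = sn e := by
  conv_lhs => rw [h.eq_mk e he]
  exact Sym2.mem_iff

end IsAdmissible

lemma instGraph_adj_inl_inl {v w : V} {i j : Fin 8} :
    (instGraph G σ fs sn).Adj (Sum.inl (v, i)) (Sum.inl (w, j)) ↔
      v = w ∧ (i.val + 1 = j.val ∨ j.val + 1 = i.val ∨ (i.val = 7 ∧ j.val = 0) ∨
        (i.val = 0 ∧ j.val = 7)) := by
  simp only [instGraph, SimpleGraph.fromRel_adj, iRel, ne_eq, Sum.inl.injEq, Prod.mk.injEq,
    Fin.ext_iff]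
  constructor
  · rintro ⟨-, ⟨rfl, h⟩ | ⟨rfl, h⟩⟩ <;> refine ⟨rfl, ?_⟩ <;> omega
  · rintro ⟨rfl, h⟩
    refine ⟨by rintro ⟨-, h'⟩; omega, ?_⟩
    simp only [true_and]
    omega

lemma not_instGraph_adj_inr_inr {x y : Sym2 V × Fin 2} :
    ¬ (instGraph G σ fs sn).Adj (Sum.inr x) (Sum.inr y) := by
  simp [instGraph, SimpleGraph.fromRel_adj, iRel]

lemma IsAdmissible.edge_unique (h : IsAdmissible G σ fs sn) {e e' : Sym2 V}
    (he : e ∈ G.edgeSet) (he' : e' ∈ G.edgeSet) {u : V} (hu : u ∈ e) (hu' : u ∈ e')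
    (hσ : σ u e = σ u e') : e = e' :=
  h.inj u ⟨he, hu⟩ ⟨he', hu'⟩ hσ

lemma instLen_pos (ε : Sym2 (IVert V)) : 1 ≤ instLen ε := by
  unfold instLen; split_ifs <;> omega

lemma instLen_closing (v : V) :
    instLen s((Sum.inl (v, (7 : Fin 8)) : IVert V), Sum.inl (v, (0 : Fin 8))) = 12 := by
  unfold instLen
  rw [if_pos ⟨v, rfl⟩]

lemma instLen_even {v : V} {i j : Fin 8} (hi : i.val % 2 = 0) (hij : i.val + 1 = j.val) :
    instLen s((Sum.inl (v, i) : IVert V), Sum.inl (v, j)) = 2 := by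
  unfold instLen
  rw [if_neg, if_pos ⟨v, i, j, hi, hij, rfl⟩]
  rintro ⟨w, hw⟩
  simp only [Sym2.eq_iff, Sum.inl.injEq, Prod.mk.injEq] at hw
  rcases hw with ⟨⟨-, rfl⟩, -, rfl⟩ | ⟨⟨-, rfl⟩, -, rfl⟩ <;> simp at hij

lemma instLen_odd {v : V} {i j : Fin 8} (hi : i.val % 2 = 1) (hij : i.val + 1 = j.val) :
    instLen s((Sum.inl (v, i) : IVert V), Sum.inl (v, j)) = 1 := by
  unfold instLen
  rw [if_neg, if_neg]
  · rintro ⟨w, i', j', hi', hij', hw⟩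
    simp only [Sym2.eq_iff, Sum.inl.injEq, Prod.mk.injEq] at hw
    rcases hw with ⟨⟨-, rfl⟩, -, rfl⟩ | ⟨⟨-, rfl⟩, -, rfl⟩ <;> omega
  · rintro ⟨w, hw⟩
    simp only [Sym2.eq_iff, Sum.inl.injEq, Prod.mk.injEq] at hw
    rcases hw with ⟨⟨-, rfl⟩, -, rfl⟩ | ⟨⟨-, rfl⟩, -, rfl⟩ <;> simp at hij

lemma instLen_inr_inl (x : Sym2 V × Fin 2) (y : V × Fin 8) :
    instLen s((Sum.inr x : IVert V), Sum.inl y) = 1 := by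
  unfold instLen
  rw [if_neg, if_neg] <;> simp

lemma exists_closing (G : SimpleGraph V) (σ : V → Sym2 V → ℕ) (fs sn : Sym2 V → V) (v : V) :
    ∃ p : (instGraph G σ fs sn).Walk (Sum.inl (v, 0)) (Sum.inl (v, 7)), p.IsPath ∧
      p.support = [Sum.inl (v, 0), Sum.inl (v, 7)] ∧
      {ε | ε ∈ p.edges} = {s(Sum.inl (v, 0), Sum.inl (v, 7))} ∧
      lengthOf instLen {s((Sum.inl (v, 0) : IVert V), Sum.inl (v, 7))} = 12 := by
  have h1 : (instGraph G σ fs sn).Adj (Sum.inl (v, 0)) (Sum.inl (v, 7)) :=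
    instGraph_adj_inl_inl.2 (by simp)
  refine ⟨.cons h1 .nil, ?_, by simp, by simp, ?_⟩
  · rw [SimpleGraph.Walk.isPath_def]
    simp
  · simp [lengthOf, Sym2.eq_swap (a := (Sum.inl (v, 0) : IVert V)), instLen_closing]

lemma exists_long (G : SimpleGraph V) (σ : V → Sym2 V → ℕ) (fs sn : Sym2 V → V) (v : V) :
    ∃ p : (instGraph G σ fs sn).Walk (Sum.inl (v, 0)) (Sum.inl (v, 7)), p.IsPath ∧
      (∀ x ∈ p.support, ∃ i, x = Sum.inl (v, i)) ∧
      {ε | ε ∈ p.edges} = longPathEdges v ∧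
      lengthOf instLen (longPathEdges v) = 11 := by
  have hadj (i j : Fin 8) (hij : i.val + 1 = j.val) :
      (instGraph G σ fs sn).Adj (Sum.inl (v, i)) (Sum.inl (v, j)) :=
    instGraph_adj_inl_inl.2 ⟨rfl, Or.inl hij⟩
  let p := SimpleGraph.Walk.cons (hadj 0 1 rfl) (.cons (hadj 1 2 rfl) (.cons (hadj 2 3 rfl)
    (.cons (hadj 3 4 rfl) (.cons (hadj 4 5 rfl) (.cons (hadj 5 6 rfl)
      (.cons (hadj 6 7 rfl) .nil))))))
  have hp : p.IsPath := by
    rw [SimpleGraph.Walk.isPath_def]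
    simp [p]
  have hedges : {ε | ε ∈ p.edges} = longPathEdges v := by
    ext ε
    simp [p, longPathEdges, Fin.exists_fin_succ]
  refine ⟨p, hp, by simp [p], hedges, ?_⟩
  rw [← hedges, lengthOf_edges _ hp]
  have heven (i j : Fin 8) := @instLen_even V v i j
  have hodd (i j : Fin 8) := @instLen_odd V v i j
  simp only [p, SimpleGraph.Walk.edges_cons, SimpleGraph.Walk.edges_nil, List.map_cons,
    List.map_nil, List.sum_cons, List.sum_nil]
  norm_num [heven 0 1 rfl rfl, hodd 1 2 rfl rfl, heven 2 3 rfl rfl, hodd 3 4 rfl rfl,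
    heven 4 5 rfl rfl, hodd 5 6 rfl rfl, heven 6 7 rfl rfl]

variable [DecidableEq V]

/-- The index of the vertex of the gadget cycle of `u` to which `w′ₖ₊₁(e)` is attached. -/
def attach (σ : V → Sym2 V → ℕ) (fs : Sym2 V → V) (e : Sym2 V) (u : V) (k : Fin 2) : Fin 8 :=
  Fin.ofNat 8 (if k = 0 ↔ u = fs e then σ u e - 1 else σ u e)

lemma IsAdmissible.attach_spec (h : IsAdmissible G σ fs sn) {e : Sym2 V}
    (he : e ∈ G.edgeSet) {u : V} (hu : u ∈ e) :
    ∃ m : ℕ, (m = 1 ∨ m = 3 ∨ m = 5) ∧ σ u e = m + 1 ∧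
      (((attach σ fs e u 0).val = m ∧ (attach σ fs e u 1).val = m + 1) ∨
        ((attach σ fs e u 0).val = m + 1 ∧ (attach σ fs e u 1).val = m)) := by
  have hm := h.mem u e ⟨he, hu⟩
  refine ⟨σ u e - 1, by omega, by omega, ?_⟩
  by_cases huf : u = fs e
  · rcases hm with hm | hm | hm <;> simp [attach, ← huf, hm]
  · rcases hm with hm | hm | hm <;> simp [attach, huf, hm]

lemma IsAdmissible.adj_inr_inl (h : IsAdmissible G σ fs sn) {e : Sym2 V} {k : Fin 2} {u : V}
    {i : Fin 8} : (instGraph G σ fs sn).Adj (Sum.inr (e, k)) (Sum.inl (u, i)) ↔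
      e ∈ G.edgeSet ∧ u ∈ e ∧ i = attach σ fs e u k := by
  simp only [instGraph, SimpleGraph.fromRel_adj, iRel, ne_eq, reduceCtorEq, not_false_eq_true,
    or_false, true_and]
  refine and_congr_right fun he => ?_
  rw [h.mem_iff he]
  have hne := h.fs_ne_sn he
  constructor
  · intro hi
    have hu : u = fs e ∨ u = sn e := by tauto
    have hm := h.mem u e ⟨he, (h.mem_iff he).2 hu⟩
    refine ⟨hu, Fin.ext ?_⟩
    rcases hi with ⟨rfl, rfl, hi⟩ | ⟨rfl, rfl, hi⟩ | ⟨rfl, rfl, hi⟩ | ⟨rfl, rfl, hi⟩ <;>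
      simp [attach, hne.symm] <;> omega
  · rintro ⟨hu, rfl⟩
    have hm := h.mem u e ⟨he, (h.mem_iff he).2 hu⟩
    obtain rfl | rfl : k = 0 ∨ k = 1 := by omega
    all_goals rcases hu with rfl | rfl <;> simp [attach, hne, hne.symm] <;> omega

lemma IsAdmissible.attach_inj (h : IsAdmissible G σ fs sn) {e e' : Sym2 V}
    (he : e ∈ G.edgeSet) (he' : e' ∈ G.edgeSet) {u : V} (hu : u ∈ e) (hu' : u ∈ e')
    {k k' : Fin 2} (hk : attach σ fs e u k = attach σ fs e' u k') : e = e' ∧ k = k' := by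
  obtain ⟨m, hm, hσ, ha⟩ := h.attach_spec he hu
  obtain ⟨m', hm', hσ', ha'⟩ := h.attach_spec he' hu'
  have hk' := congrArg Fin.val hk
  obtain rfl | rfl : k = 0 ∨ k = 1 := by omega
  all_goals
    obtain rfl | rfl : k' = 0 ∨ k' = 1 := by omega
    all_goals
      obtain rfl := h.edge_unique he he' hu hu' (by omega)
      simp
  all_goals omega

/-- The edge set of the path `w′₁(e) u′ᵢ u′ⱼ w′₂(e)` of length `3` through the gadget cycle
of an endpoint `u` of `e`. -/
def hopEdges (σ : V → Sym2 V → ℕ) (fs : Sym2 V → V) (e : Sym2 V) (u : V) :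
    Set (Sym2 (IVert V)) :=
  {s(Sum.inr (e, 0), Sum.inl (u, attach σ fs e u 0)),
    s(Sum.inl (u, attach σ fs e u 0), Sum.inl (u, attach σ fs e u 1)),
    s(Sum.inl (u, attach σ fs e u 1), Sum.inr (e, 1))}

lemma exists_hop (h : IsAdmissible G σ fs sn) {e : Sym2 V} (he : e ∈ G.edgeSet) {u : V}
    (hu : u ∈ e) :
    ∃ p : (instGraph G σ fs sn).Walk (Sum.inr (e, 0)) (Sum.inr (e, 1)), p.IsPath ∧
      p.support = [Sum.inr (e, 0), Sum.inl (u, attach σ fs e u 0),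
        Sum.inl (u, attach σ fs e u 1), Sum.inr (e, 1)] ∧
      {ε | ε ∈ p.edges} = hopEdges σ fs e u ∧ lengthOf instLen (hopEdges σ fs e u) = 3 := by
  obtain ⟨m, hm, hσ, ha⟩ := h.attach_spec he hu
  have h1 : (instGraph G σ fs sn).Adj (Sum.inr (e, 0)) (Sum.inl (u, attach σ fs e u 0)) :=
    h.adj_inr_inl.2 ⟨he, hu, rfl⟩
  have h2 : (instGraph G σ fs sn).Adj (Sum.inl (u, attach σ fs e u 0))
      (Sum.inl (u, attach σ fs e u 1)) := instGraph_adj_inl_inl.2 ⟨rfl, by omega⟩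
  have h3 : (instGraph G σ fs sn).Adj (Sum.inl (u, attach σ fs e u 1)) (Sum.inr (e, 1)) :=
    (h.adj_inr_inl.2 ⟨he, hu, rfl⟩).symm
  let p := SimpleGraph.Walk.cons h1 (.cons h2 (.cons h3 .nil))
  have hp : p.IsPath := by
    rw [SimpleGraph.Walk.isPath_def]
    have : attach σ fs e u 0 ≠ attach σ fs e u 1 := fun h => by rw [h] at ha; omega
    simp [p, this]
  have hedges : {ε | ε ∈ p.edges} = hopEdges σ fs e u := by
    ext ε; simp [p, hopEdges]
  refine ⟨p, hp, by simp [p], hedges, ?_⟩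
  rw [← hedges, lengthOf_edges _ hp]
  have h4 : instLen s((Sum.inl (u, attach σ fs e u 0) : IVert V),
      Sum.inl (u, attach σ fs e u 1)) = 1 := by
    rcases ha with ha | ha
    · exact instLen_odd (by omega) (by omega)
    · rw [Sym2.eq_swap]
      exact instLen_odd (by omega) (by omega)
  have h5 : instLen s((Sum.inl (u, attach σ fs e u 1) : IVert V), Sum.inr (e, 1)) = 1 := by
    rw [Sym2.eq_swap, instLen_inr_inl]
  simp [p, h4, h5, instLen_inr_inl]

lemma edges_of_ascending [Fintype V] [DecidableRel G.Adj] (h : IsAdmissible G σ fs sn)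
    {x b : IVert V} (p : (instGraph G σ fs sn).Walk x b) (v : V) (j : Fin 8)
    (hx : x = Sum.inl (v, j)) (hj : j ≠ 0) (hp : p.IsPath) (hb : b ∈ instA V)
    (hprev : ∀ i : Fin 8, i.val + 1 = j.val → Sum.inl (v, i) ∉ p.support)
    (hzero : Sum.inl (v, 0) ∉ p.support)
    (hT : ∀ y ∈ p.support, y ∈ instA V ∪ instB G → y = b) :
    b = Sum.inl (v, 7) ∧ {ε | ε ∈ p.edges} =
      {ε | ∃ i : Fin 8, j ≤ i ∧ i.val < 7 ∧ ε = s(Sum.inl (v, i), Sum.inl (v, i + 1))} := by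
  induction p generalizing j with
  | nil =>
    subst hx
    obtain rfl : j = 7 := by
      simp only [instA, Finset.mem_union, Finset.mem_image, Finset.mem_univ, true_and,
        Sum.inl.injEq, Prod.mk.injEq] at hb
      grind
    refine ⟨rfl, ?_⟩
    ext ε
    simp only [SimpleGraph.Walk.edges_nil, List.not_mem_nil, Set.mem_ofPred_eq, false_iff]
    rintro ⟨i, h1, h2, -⟩
    have h7 : (7 : Fin 8).val ≤ i.val := h1
    exact absurd h2 (by simpa using h7)
  | @cons x y b hxy q ih =>
    subst hx
    rw [SimpleGraph.Walk.cons_isPath_iff] at hp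
    have hxT : (Sum.inl (v, j) : IVert V) ∉ instA V ∪ instB G := fun hmem =>
      hp.2 (by rw [hT _ (by simp) hmem]; exact q.end_mem_support)
    have hj7 : j ≠ 7 := by
      rintro rfl
      simp [instA] at hxT
    rcases y with ⟨w, i⟩ | ⟨e, k⟩
    · obtain ⟨rfl, hij⟩ := instGraph_adj_inl_inl.1 hxy
      have hi1 : j.val + 1 = i.val := by
        have := hprev i
        simp only [SimpleGraph.Walk.support_cons, List.mem_cons, q.start_mem_support, or_true,
          not_true_eq_false, imp_false] at this
        omega
      obtain ⟨rfl, hq⟩ := ih i rfl (by omega) hp.1 hb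
        (fun i' hi' => by
          obtain rfl : i' = j := by omega
          exact hp.2)
        (fun h0 => hzero (by simp [h0]))
        (fun y hy => hT y (by simp [hy]))
      refine ⟨rfl, ?_⟩
      obtain rfl : i = j + 1 := by
        apply Fin.ext
        rw [Fin.val_add_one]
        grind
      ext ε
      have hq' := Set.ext_iff.1 hq ε
      simp only [Set.mem_ofPred_eq] at hq'
      simp only [SimpleGraph.Walk.edges_cons, List.mem_cons, Set.mem_ofPred_eq, hq']
      constructor
      · rintro (rfl | ⟨i, h1, h2, rfl⟩)
        · exact ⟨j, le_rfl, by omega, rfl⟩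
        · exact ⟨i, by omega, h2, rfl⟩
      · rintro ⟨i, h1, h2, rfl⟩
        rcases eq_or_ne i j with rfl | hne
        · exact Or.inl rfl
        · exact Or.inr ⟨i, by omega, h2, rfl⟩
    · obtain ⟨he, -⟩ := h.adj_inr_inl.1 hxy.symm
      have hbe : (Sum.inr (e, k) : IVert V) = b := hT _ (by simp) (by
        obtain rfl | rfl : k = 0 ∨ k = 1 := by omega
        all_goals simpa [instA, instB] using he)
      subst hbe
      simp [instA] at hb

lemma edges_of_path_instA [Fintype V] [DecidableRel G.Adj] (h : IsAdmissible G σ fs sn)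
    {v : V} {b : IVert V} (p : (instGraph G σ fs sn).Walk (Sum.inl (v, 0)) b) (hp : p.IsPath)
    (hb : b ∈ instA V) (hne : Sum.inl (v, 0) ≠ b)
    (hT : ∀ y ∈ p.support, y ∈ instA V ∪ instB G → y = Sum.inl (v, 0) ∨ y = b) :
    b = Sum.inl (v, 7) ∧ ({ε | ε ∈ p.edges} = longPathEdges v ∨
      {ε | ε ∈ p.edges} = {s(Sum.inl (v, 0), Sum.inl (v, 7))}) := by
  cases p with
  | nil => exact absurd rfl hne
  | @cons _ y _ hxy q =>
    rw [SimpleGraph.Walk.cons_isPath_iff] at hp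
    rcases y with ⟨w, i⟩ | ⟨e, k⟩
    · obtain ⟨rfl, hij⟩ := instGraph_adj_inl_inl.1 hxy
      obtain rfl | rfl : i = 1 ∨ i = 7 := by
        simp only [Fin.val_zero] at hij
        omega
      · obtain ⟨rfl, hq⟩ := edges_of_ascending h q v 1 rfl (by simp) hp.1 hb
          (fun i hi => by
            obtain rfl : i = 0 := by simpa using hi
            exact hp.2) hp.2
          (fun y hy hyT => (hT y (by simp [hy]) hyT).resolve_left (by
            rintro rfl
            exact hp.2 hy))
        refine ⟨rfl, Or.inl ?_⟩
        ext ε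
        have hq' := Set.ext_iff.1 hq ε
        simp only [Set.mem_ofPred_eq] at hq'
        simp only [SimpleGraph.Walk.edges_cons, List.mem_cons, Set.mem_ofPred_eq, hq',
          longPathEdges]
        constructor
        · rintro (rfl | ⟨i, h1, h2, rfl⟩)
          · exact ⟨0, by simp, rfl⟩
          · exact ⟨i, h2, rfl⟩
        · rintro ⟨i, h2, rfl⟩
          rcases eq_or_ne i 0 with rfl | hne
          · exact Or.inl rfl
          · exact Or.inr ⟨i, by omega, h2, rfl⟩
      · have hb7 : (Sum.inl (v, 7) : IVert V) = b :=
          (hT _ (by simp) (by simp [instA])).resolve_left (by simp)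
        subst hb7
        refine ⟨rfl, Or.inr ?_⟩
        rw [(SimpleGraph.Walk.isPath_iff_nil).1 hp.1 |>.eq_nil]
        ext; simp
    · obtain ⟨he, -⟩ := h.adj_inr_inl.1 hxy.symm
      have hbe : (Sum.inr (e, k) : IVert V) = b := (hT _ (by simp) (by
        obtain rfl | rfl : k = 0 ∨ k = 1 := by omega
        all_goals simpa [instA, instB] using he)).resolve_left (by simp)
      subst hbe
      simp [instA] at hb

lemma IsAdmissible.hop_of_adj (h : IsAdmissible G σ fs sn) {e e' : Sym2 V} {k k' : Fin 2}
    {x y : IVert V} (hne : (Sum.inr (e, k) : IVert V) ≠ Sum.inr (e', k'))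
    (h1 : (instGraph G σ fs sn).Adj (Sum.inr (e, k)) x) (h2 : (instGraph G σ fs sn).Adj x y)
    (h3 : (instGraph G σ fs sn).Adj y (Sum.inr (e', k'))) (hlen : instLen s(x, y) = 1) :
    ∃ u ∈ e,
      ({s(Sum.inr (e, k), x), s(x, y), s(y, Sum.inr (e', k'))} : Set (Sym2 (IVert V))) =
        hopEdges σ fs e u := by
  obtain ⟨u, i⟩ | _ := x
  swap
  · exact absurd h1 not_instGraph_adj_inr_inr
  obtain ⟨u', i'⟩ | _ := y
  swap
  · exact absurd h3 not_instGraph_adj_inr_inr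
  obtain ⟨rfl, hij⟩ := instGraph_adj_inl_inl.1 h2
  obtain ⟨he, hu, rfl⟩ := h.adj_inr_inl.1 h1
  obtain ⟨he', hu', rfl⟩ := h.adj_inr_inl.1 h3.symm
  have hodd1 : ¬ ((attach σ fs e u k).val % 2 = 0 ∧
      (attach σ fs e u k).val + 1 = (attach σ fs e' u k').val) := by
    rintro ⟨heven, hs⟩
    rw [instLen_even heven hs] at hlen
    omega
  have hodd2 : ¬ ((attach σ fs e' u k').val % 2 = 0 ∧
      (attach σ fs e' u k').val + 1 = (attach σ fs e u k).val) := by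
    rintro ⟨heven, hs⟩
    rw [Sym2.eq_swap, instLen_even heven hs] at hlen
    omega
  obtain ⟨m, hm, hσ, ha⟩ := h.attach_spec he hu
  obtain ⟨m', hm', hσ', ha'⟩ := h.attach_spec he' hu'
  obtain rfl : e = e' := by
    refine h.edge_unique he he' hu hu' ?_
    obtain rfl | rfl : k = 0 ∨ k = 1 := by omega
    all_goals
      obtain rfl | rfl : k' = 0 ∨ k' = 1 := by omega
      all_goals omega
  refine ⟨u, hu, ?_⟩
  obtain ⟨rfl, rfl⟩ | ⟨rfl, rfl⟩ : (k = 0 ∧ k' = 1) ∨ (k = 1 ∧ k' = 0) := by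
    have : k ≠ k' := by
      rintro rfl
      exact hne rfl
    omega
  · rfl
  · rw [hopEdges, Sym2.eq_swap (a := (Sum.inr (e, 1) : IVert V)),
      Sym2.eq_swap (b := (Sum.inr (e, 0) : IVert V)),
      Sym2.eq_swap (a := (Sum.inl (u, attach σ fs e u 1) : IVert V))
        (b := (Sum.inl (u, attach σ fs e u 0) : IVert V)),
      Set.insert_comm, Set.pair_comm _ s(Sum.inr (e, 0), _), Set.insert_comm]

lemma edges_of_path_instB (h : IsAdmissible G σ fs sn) {x x' : Sym2 V × Fin 2}
    (p : (instGraph G σ fs sn).Walk (Sum.inr x) (Sum.inr x')) (hp : p.IsPath) (hne : x ≠ x') :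
    3 ≤ lengthOf instLen {ε | ε ∈ p.edges} ∧
      (lengthOf instLen {ε | ε ∈ p.edges} = 3 →
        ∃ u ∈ x.1, {ε | ε ∈ p.edges} = hopEdges σ fs x.1 u) := by
  obtain ⟨e, k⟩ := x
  obtain ⟨e', k'⟩ := x'
  rw [lengthOf_edges _ hp]
  cases p with
  | nil => exact absurd rfl hne
  | @cons _ x _ h1 q =>
    cases q with
    | nil => exact absurd h1 not_instGraph_adj_inr_inr
    | @cons _ y _ h2 q =>
      cases q with
      | nil =>
        obtain ⟨u, i⟩ | _ := x
        · obtain ⟨he, hu, hi⟩ := h.adj_inr_inl.1 h1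
          obtain ⟨he', hu', hi'⟩ := h.adj_inr_inl.1 h2.symm
          obtain ⟨rfl, rfl⟩ := h.attach_inj he he' hu hu' (hi.symm.trans hi')
          exact absurd rfl hne
        · exact absurd h1 not_instGraph_adj_inr_inr
      | @cons _ z _ h3 q =>
        have l1 := instLen_pos s((Sum.inr (e, k) : IVert V), x)
        have l2 := instLen_pos s(x, y)
        have l3 := instLen_pos s(y, z)
        cases q with
        | nil =>
          simp only [SimpleGraph.Walk.edges_cons, SimpleGraph.Walk.edges_nil, List.map_cons,
            List.map_nil, List.sum_cons, List.sum_nil]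
          refine ⟨by omega, fun hlen => ?_⟩
          obtain ⟨u, hu, hedges⟩ := h.hop_of_adj (by simpa using hne) h1 h2 h3 (by omega)
          refine ⟨u, hu, ?_⟩
          rw [← hedges]
          ext; simp
        | @cons _ t _ h4 q =>
          have l4 := instLen_pos s(z, t)
          simp only [SimpleGraph.Walk.edges_cons, List.map_cons, List.sum_cons]
          exact ⟨by omega, fun hlen => by omega⟩

section Solutions

/-- The edges of the path joining `v′₁` and `v′₈`: the long path if `v ∈ S`, and the single
edge `v′₈v′₁` otherwise. -/
def spineEdges (S : Finset V) (v : V) : Set (Sym2 (IVert V)) :=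
  if v ∈ S then longPathEdges v else {s(Sum.inl (v, 0), Sum.inl (v, 7))}

lemma mem_mem_spineEdges {S : Finset V} {v : V} {ε : Sym2 (IVert V)} (hε : ε ∈ spineEdges S v)
    {x : IVert V} (hx : x ∈ ε) : ∃ i, x = Sum.inl (v, i) := by
  unfold spineEdges at hε
  split_ifs at hε
  · obtain ⟨j, -, rfl⟩ := hε
    rcases Sym2.mem_iff.1 hx with rfl | rfl <;> simp
  · rw [Set.mem_singleton_iff] at hε
    subst hε
    rcases Sym2.mem_iff.1 hx with rfl | rfl <;> simp

lemma exists_spine (G : SimpleGraph V) (σ : V → Sym2 V → ℕ) (fs sn : Sym2 V → V)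
    (S : Finset V) (v : V) :
    ∃ p : (instGraph G σ fs sn).Walk (Sum.inl (v, 0)) (Sum.inl (v, 7)), p.IsPath ∧
      (∀ x ∈ p.support, ∃ i, x = Sum.inl (v, i) ∧ (v ∈ S ∨ i = 0 ∨ i = 7)) ∧
      {ε | ε ∈ p.edges} = spineEdges S v ∧
      lengthOf instLen (spineEdges S v) = if v ∈ S then 11 else 12 := by
  by_cases hv : v ∈ S
  · obtain ⟨p, hp, hsupp, hedges, hlen⟩ := exists_long G σ fs sn v
    exact ⟨p, hp, by simpa [hv] using hsupp, by simpa [spineEdges, hv] using hedges,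
      by simpa [spineEdges, hv] using hlen⟩
  · obtain ⟨p, hp, hsupp, hedges, hlen⟩ := exists_closing G σ fs sn v
    exact ⟨p, hp, by simp [hsupp, hv], by simpa [spineEdges, hv] using hedges,
      by simpa [spineEdges, hv] using hlen⟩

/-- `c` selects for every edge of `G` an endpoint outside `S`. -/
def IsRouting (G : SimpleGraph V) (S : Finset V) (c : Sym2 V → V) : Prop :=
  ∀ e ∈ G.edgeSet, c e ∈ e ∧ c e ∉ S

/-- The edge set in which the cycles of the vertices of `S` use their long paths, the other
cycles use their closing edges, and each edge `e` of `G` is routed through the cycle of `c e`. -/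
def routedEdges (G : SimpleGraph V) (σ : V → Sym2 V → ℕ) (fs : Sym2 V → V) (S : Finset V)
    (c : Sym2 V → V) : Set (Sym2 (IVert V)) :=
  (⋃ v, spineEdges S v) ∪ ⋃ e ∈ G.edgeSet, hopEdges σ fs e (c e)

lemma routedEdges_congr {S : Finset V} {c c' : Sym2 V → V} (hcc : ∀ e ∈ G.edgeSet, c e = c' e) :
    routedEdges G σ fs S c = routedEdges G σ fs S c' := by
  unfold routedEdges
  congr 1
  exact Set.iUnion₂_congr fun e he => by rw [hcc e he]

lemma eq_of_routedEdges_eq {S : Finset V} {c c' : Sym2 V → V}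
    (hcc : routedEdges G σ fs S c = routedEdges G σ fs S c') {e : Sym2 V} (he : e ∈ G.edgeSet) :
    c e = c' e := by
  have hmem : s((Sum.inr (e, 0) : IVert V), Sum.inl (c e, attach σ fs e (c e) 0)) ∈
      routedEdges G σ fs S c' := by
    rw [← hcc]
    exact Or.inr (Set.mem_biUnion he (Or.inl rfl))
  rcases hmem with hmem | hmem
  · obtain ⟨v, hv⟩ := Set.mem_iUnion.1 hmem
    obtain ⟨i, hi⟩ := mem_mem_spineEdges hv (Sym2.mem_mk_left _ _)
    simp at hi
  · obtain ⟨e', -, hmem⟩ := Set.mem_iUnion₂.1 hmem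
    simp only [hopEdges, Set.mem_insert_iff, Set.mem_singleton_iff, Sym2.eq_iff, reduceCtorEq,
      Sum.inl.injEq, Sum.inr.injEq, Prod.mk.injEq, false_and, and_false, or_false,
      zero_ne_one, and_true] at hmem
    obtain ⟨rfl, h, -⟩ := hmem
    exact h

/-- The routing which avoids `S` and otherwise sends exactly the edges of `T` to their first
endpoint. -/
def routeBy (fs sn : Sym2 V → V) (S : Finset V) (T : Finset (Sym2 V)) (e : Sym2 V) : V :=
  if fs e ∈ S then sn e else if sn e ∈ S then fs e else if e ∈ T then fs e else sn e

lemma isRouting_routeBy (h : IsAdmissible G σ fs sn) {S : Finset V}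
    (hS : ∀ u ∈ S, ∀ w ∈ S, ¬ G.Adj u w) (T : Finset (Sym2 V)) :
    IsRouting G S (routeBy fs sn S T) := by
  intro e he
  have hadj : G.Adj (fs e) (sn e) := by
    rw [h.eq_mk e he] at he
    exact he
  have hnot : fs e ∈ S → sn e ∉ S := fun h1 h2 => hS _ h1 _ h2 hadj
  rw [h.mem_iff he]
  unfold routeBy
  split_ifs <;> tauto

variable [Fintype V]

lemma card_instA : (instA V).card = 2 * Fintype.card V := by
  rw [instA, Finset.card_union_of_disjoint, Finset.card_image_of_injective,
    Finset.card_image_of_injective, Finset.card_univ, two_mul]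
  · intro u v; simp
  · intro u v; simp
  · simp [Finset.disjoint_left]

variable [DecidableRel G.Adj]

lemma card_instB : (instB G).card = 2 * G.edgeFinset.card := by
  rw [instB, Finset.card_union_of_disjoint, Finset.card_image_of_injective,
    Finset.card_image_of_injective, two_mul]
  · intro u v; simp
  · intro u v; simp
  · simp [Finset.disjoint_left]

lemma disjoint_instA_instB : Disjoint (instA V) (instB G) := by
  simp only [Finset.disjoint_left, instA, instB, Finset.mem_union, Finset.mem_image]
  rintro _ (⟨v, -, rfl⟩ | ⟨v, -, rfl⟩) <;> simp

lemma mem_instA {x : IVert V} :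
    x ∈ instA V ↔ ∃ v, x = Sum.inl (v, 0) ∨ x = Sum.inl (v, 7) := by
  simp only [instA, Finset.mem_union, Finset.mem_image, Finset.mem_univ, true_and, exists_or,
    eq_comm]

lemma mem_instB {x : IVert V} :
    x ∈ instB G ↔ ∃ e ∈ G.edgeSet, ∃ k, x = Sum.inr (e, k) := by
  simp only [instB, Finset.mem_union, Finset.mem_image, SimpleGraph.mem_edgeFinset]
  constructor
  · rintro (⟨e, he, rfl⟩ | ⟨e, he, rfl⟩)
    exacts [⟨e, he, 0, rfl⟩, ⟨e, he, 1, rfl⟩]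
  · rintro ⟨e, he, k, rfl⟩
    obtain rfl | rfl : k = 0 ∨ k = 1 := by omega
    exacts [Or.inl ⟨e, he, rfl⟩, Or.inr ⟨e, he, rfl⟩]

lemma sum_length_spineEdges (G : SimpleGraph V) (σ : V → Sym2 V → ℕ) (fs sn : Sym2 V → V)
    (S : Finset V) :
    ∑ v, lengthOf instLen (spineEdges S v) + S.card = 12 * Fintype.card V := by
  have h1 : S.card = ∑ v, if v ∈ S then 1 else 0 := by simp
  rw [h1, ← Finset.sum_add_distrib, mul_comm, ← smul_eq_mul, Fintype.card, ← Finset.sum_const]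
  refine Finset.sum_congr rfl fun v _ => ?_
  obtain ⟨-, -, -, -, h⟩ := exists_spine G σ fs sn S v
  rw [h]
  split_ifs <;> rfl

lemma IsRouting.exists_family (h : IsAdmissible G σ fs sn) {S : Finset V} {c : Sym2 V → V}
    (hc : IsRouting G S c) :
    ∃ (k : ℕ) (f : Fin k → (u : IVert V) × (w : IVert V) × (instGraph G σ fs sn).Walk u w),
      IsPathFamily (instGraph G σ fs sn) (instA V) (instB G) (routedEdges G σ fs S c) f ∧
      (∀ v, v ∈ S ↔ ∃ i, {ε | ε ∈ (f i).2.2.edges} = longPathEdges v) ∧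
      lengthOf instLen (routedEdges G σ fs S c) + S.card =
        12 * Fintype.card V + 3 * G.edgeFinset.card := by
  choose p hp hpsupp hpedges hplen using exists_spine G σ fs sn S
  choose q hq hqsupp hqedges hqlen using fun e : G.edgeSet =>
    exists_hop h e.2 (hc e.1 e.2).1
  let F : V ⊕ G.edgeSet → (u : IVert V) × (w : IVert V) × (instGraph G σ fs sn).Walk u w :=
    Sum.elim (fun v => ⟨_, _, p v⟩) (fun e => ⟨_, _, q e⟩)
  have hcard : Fintype.card (V ⊕ G.edgeSet) = ((instA V).card + (instB G).card) / 2 := by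
    rw [card_instA, card_instB, Fintype.card_sum, ← SimpleGraph.edgeFinset_card]
    omega
  let E := (Fintype.equivFinOfCardEq hcard).symm
  have hunion : (⋃ i, {ε | ε ∈ (F i).2.2.edges}) = routedEdges G σ fs S c := by
    rw [Set.iUnion_sum, routedEdges, Set.biUnion_eq_iUnion]
    congr 1
    · exact Set.iUnion_congr hpedges
    · exact Set.iUnion_congr hqedges
  have hfam : IsPathFamily (instGraph G σ fs sn) (instA V) (instB G) (routedEdges G σ fs S c)
      (F ∘ E) := by
    rw [← hunion]
    refine isPathFamily_comp_equiv E F rfl ?_ ?_ ?_ ?_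
    · rintro (v | e)
      exacts [hp v, hq e]
    · rintro (v | e)
      · exact Or.inl ⟨mem_instA.2 ⟨v, Or.inl rfl⟩, mem_instA.2 ⟨v, Or.inr rfl⟩⟩
      · exact Or.inr ⟨mem_instB.2 ⟨e, e.2, 0, rfl⟩, mem_instB.2 ⟨e, e.2, 1, rfl⟩⟩
    · have hpq (v : V) (e : G.edgeSet) (x : IVert V) (hx : x ∈ (p v).support)
          (hx' : x ∈ (q e).support) : False := by
        obtain ⟨i, rfl, hi⟩ := hpsupp v x hx
        obtain ⟨hce, hcS⟩ := hc e.1 e.2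
        obtain ⟨m, hm, -, ha⟩ := h.attach_spec e.2 hce
        simp only [hqsupp, List.mem_cons, reduceCtorEq, Sum.inl.injEq, Prod.mk.injEq,
          List.not_mem_nil, or_false, false_or, Fin.ext_iff] at hx'
        rcases hi with hi | rfl | rfl
        · rcases hx' with ⟨rfl, -⟩ | ⟨rfl, -⟩ <;> exact hcS hi
        · rcases hx' with ⟨-, hi⟩ | ⟨-, hi⟩ <;> simp only [Fin.val_zero] at hi <;> omega
        · rcases hx' with ⟨-, hi⟩ | ⟨-, hi⟩ <;>
            simp only [show (7 : Fin 8).val = 7 from rfl] at hi <;> omega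
      rintro (v | e) (v' | e') x hx hx'
      · obtain ⟨i, rfl, -⟩ := hpsupp v x hx
        obtain ⟨i', hi', -⟩ := hpsupp v' _ hx'
        simp only [Sum.inl.injEq, Prod.mk.injEq] at hi'
        rw [hi'.1]
      · exact (hpq v e' x hx hx').elim
      · exact (hpq v' e x hx' hx).elim
      · obtain ⟨hce, -⟩ := hc e.1 e.2
        obtain ⟨hce', -⟩ := hc e'.1 e'.2
        have hatt (k k' : Fin 2) (hu : c e = c e')
            (hk : attach σ fs e (c e) k = attach σ fs e' (c e') k') : e = e' := by
          rw [← hu] at hk hce'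
          exact Subtype.ext (h.attach_inj e.2 e'.2 hce hce' hk).1
        replace hx : x ∈ (q e).support := hx
        replace hx' : x ∈ (q e').support := hx'
        simp only [hqsupp, List.mem_cons, List.not_mem_nil, or_false] at hx hx'
        congr 1
        rcases hx with rfl | rfl | rfl | rfl <;>
          simp only [reduceCtorEq, Sum.inl.injEq, Sum.inr.injEq, Prod.mk.injEq, false_or,
            or_false] at hx'
        · rcases hx' with hx' | hx' <;> exact Subtype.ext hx'.1
        · rcases hx' with hx' | hx' <;> exact hatt _ _ hx'.1 hx'.2
        · rcases hx' with hx' | hx' <;> exact hatt _ _ hx'.1 hx'.2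
        · rcases hx' with hx' | hx' <;> exact Subtype.ext hx'.1
    · intro z hz
      rcases Finset.mem_union.1 hz with hz | hz
      · obtain ⟨v, hv⟩ := mem_instA.1 hz
        exact ⟨Sum.inl v, hv⟩
      · obtain ⟨e, he, k, rfl⟩ := mem_instB.1 hz
        refine ⟨Sum.inr ⟨e, he⟩, ?_⟩
        obtain rfl | rfl : k = 0 ∨ k = 1 := by omega
        exacts [Or.inl rfl, Or.inr rfl]
  refine ⟨_, _, hfam, fun v => ⟨fun hv => ?_, ?_⟩, ?_⟩
  · obtain ⟨i, hi⟩ := E.surjective (Sum.inl v)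
    refine ⟨i, ?_⟩
    rw [Function.comp_apply, hi]
    exact (hpedges v).trans (by simp [spineEdges, hv])
  · rintro ⟨i, hi⟩
    have hmem : s((Sum.inl (v, 0) : IVert V), Sum.inl (v, 1)) ∈
        {ε | ε ∈ ((F ∘ E) i).2.2.edges} := by
      rw [hi]
      exact ⟨0, by simp, rfl⟩
    rw [Function.comp_apply] at hmem
    by_contra hv
    generalize E i = z at hmem
    rcases z with w | e
    · replace hmem := (Set.ext_iff.1 (hpedges w) _).1 hmem
      obtain ⟨j, hj⟩ := mem_mem_spineEdges hmem (Sym2.mem_mk_left _ _)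
      simp only [Sum.inl.injEq, Prod.mk.injEq] at hj
      obtain ⟨rfl, -⟩ := hj
      simp [spineEdges, hv] at hmem
    · replace hmem := (Set.ext_iff.1 (hqedges e) _).1 hmem
      obtain ⟨m, hm, -, ha⟩ := h.attach_spec e.2 (hc e.1 e.2).1
      simp only [hopEdges, Set.mem_insert_iff, Set.mem_singleton_iff, Sym2.eq_iff, reduceCtorEq,
        Sum.inl.injEq, Prod.mk.injEq, false_and, and_false, or_false, false_or, Fin.ext_iff,
        Fin.val_zero] at hmem
      omega
  · rw [hfam.lengthOf_eq]
    simp only [Function.comp_apply]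
    rw [E.sum_comp fun i => lengthOf instLen {ε | ε ∈ (F i).2.2.edges},
      Fintype.sum_sum_type, ← sum_length_spineEdges G σ fs sn S, add_right_comm]
    congr 2
    · exact Finset.sum_congr rfl fun v _ => congrArg _ (hpedges v)
    · refine (Finset.sum_congr rfl fun e _ =>
        (congrArg _ (hqedges e)).trans (hqlen e)).trans ?_
      rw [Finset.sum_const, Finset.card_univ, smul_eq_mul, mul_comm, SimpleGraph.edgeFinset_card]

lemma IsPathFamily.exists_spine_index (h : IsAdmissible G σ fs sn) {k : ℕ}
    {f : Fin k → (u : IVert V) × (w : IVert V) × (instGraph G σ fs sn).Walk u w}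
    {E' : Set (Sym2 (IVert V))}
    (hf : IsPathFamily (instGraph G σ fs sn) (instA V) (instB G) E' f)
    (hk : 2 * k = (instA V).card + (instB G).card) {S : Finset V}
    (hS : ∀ v, v ∈ S ↔ ∃ i, {ε | ε ∈ (f i).2.2.edges} = longPathEdges v) (v : V) :
    ∃ i, Sum.inl (v, 0) ∈ (f i).2.2.support ∧ Sum.inl (v, 7) ∈ (f i).2.2.support ∧
      {ε | ε ∈ (f i).2.2.edges} = spineEdges S v := by
  have hvA : (Sum.inl (v, 0) : IVert V) ∈ instA V := mem_instA.2 ⟨v, Or.inl rfl⟩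
  obtain ⟨i, b, p, hp, hne, hend, hsupp, hedges, hT⟩ :=
    hf.exists_path_from hk disjoint_instA_instB (Finset.mem_union_left _ hvA)
  have hb : b ∈ instA V := hend.elim And.right fun hB =>
    absurd hB.1 (Finset.disjoint_left.1 disjoint_instA_instB hvA)
  obtain ⟨rfl, hpe⟩ := edges_of_path_instA h p hp hb hne hT
  have h0 := (hsupp _).1 p.start_mem_support
  refine ⟨i, h0, (hsupp _).1 p.end_mem_support, ?_⟩
  rw [hedges] at hpe
  unfold spineEdges
  split_ifs with hv
  · obtain ⟨j, hj⟩ := (hS v).1 hv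
    have hmem : s((Sum.inl (v, 0) : IVert V), Sum.inl (v, 1)) ∈
        {ε | ε ∈ (f j).2.2.edges} := by
      rw [hj]
      exact ⟨0, by simp, rfl⟩
    rw [hf.index_unique h0 (SimpleGraph.Walk.fst_mem_support_of_mem_edges _ hmem), hj]
  · exact hpe.resolve_left fun hl => hv ((hS v).2 ⟨i, hl⟩)

lemma IsPathFamily.eq_routedEdges (h : IsAdmissible G σ fs sn) {k : ℕ}
    {f : Fin k → (u : IVert V) × (w : IVert V) × (instGraph G σ fs sn).Walk u w}
    {E' : Set (Sym2 (IVert V))}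
    (hf : IsPathFamily (instGraph G σ fs sn) (instA V) (instB G) E' f) {S : Finset V}
    (hS : ∀ v, v ∈ S ↔ ∃ i, {ε | ε ∈ (f i).2.2.edges} = longPathEdges v)
    (hlen : lengthOf instLen E' + S.card = 12 * Fintype.card V + 3 * G.edgeFinset.card) :
    ∃ c, IsRouting G S c ∧ E' = routedEdges G σ fs S c := by
  have hk' : k = Fintype.card V + G.edgeFinset.card := by
    rw [hf.1, card_instA, card_instB]
    omega
  have hk : 2 * k = (instA V).card + (instB G).card := by
    rw [hk', card_instA, card_instB]
    ring
  choose ι hι0 hι7 hιe using hf.exists_spine_index h hk hS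
  have hend (v : V) (x : IVert V) (hx : x ∈ (f (ι v)).2.2.support)
      (hxT : x ∈ instA V ∪ instB G) : x = Sum.inl (v, 0) ∨ x = Sum.inl (v, 7) := by
    have h0 := hf.eq_endpoint (hι0 v) (Finset.mem_union_left _ (mem_instA.2 ⟨v, Or.inl rfl⟩))
    have h7 := hf.eq_endpoint (hι7 v) (Finset.mem_union_left _ (mem_instA.2 ⟨v, Or.inr rfl⟩))
    have h07 : (Sum.inl (v, 0) : IVert V) ≠ Sum.inl (v, 7) := by simp
    have hx' := hf.eq_endpoint hx hxT
    grind
  have hιinj : Function.Injective ι := by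
    intro u v huv
    have := hend v (Sum.inl (u, 0)) (huv ▸ hι0 u)
      (Finset.mem_union_left _ (mem_instA.2 ⟨u, Or.inl rfl⟩))
    simpa using this
  have hsplit (i : Fin k) (hi : ∀ v, ι v ≠ i) :
      ∃ x x', x ≠ x' ∧ x.1 ∈ G.edgeSet ∧
        ∃ p : (instGraph G σ fs sn).Walk (Sum.inr x) (Sum.inr x'), p.IsPath ∧
          {ε | ε ∈ p.edges} = {ε | ε ∈ (f i).2.2.edges} ∧
          Sum.inr x ∈ (f i).2.2.support := by
    have hne := hf.endpoints_ne hk disjoint_instA_instB i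
    have hpath := hf.2.1 i
    have hends : (f i).1 ∈ instB G ∧ (f i).2.1 ∈ instB G := by
      refine (hf.2.2.1 i).resolve_left fun hA => ?_
      obtain ⟨v, hv⟩ := mem_instA.1 hA.1
      refine hi v (hf.index_unique (x := (f i).1) ?_ (SimpleGraph.Walk.start_mem_support _))
      rcases hv with hv | hv <;> rw [hv]
      exacts [hι0 v, hι7 v]
    clear hi
    generalize f i = t at *
    obtain ⟨a, b, p⟩ := t
    obtain ⟨e, he, l, rfl⟩ := mem_instB.1 hends.1
    obtain ⟨e', he', l', rfl⟩ := mem_instB.1 hends.2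
    exact ⟨(e, l), (e', l'), by simpa using hne, he, p, hpath, rfl, p.start_mem_support⟩
  let R : Finset (Fin k) := Finset.univ \ Finset.univ.image ι
  have hR (i : Fin k) : i ∈ R ↔ ∀ v, ι v ≠ i := by simp [R]
  have hRcard : R.card = G.edgeFinset.card := by
    rw [Finset.card_sdiff_of_subset (Finset.subset_univ _), Finset.card_image_of_injective _ hιinj]
    simp [hk']
  have hge (i : Fin k) (hi : i ∈ R) : 3 ≤ lengthOf instLen {ε | ε ∈ (f i).2.2.edges} := by
    obtain ⟨x, x', hne, -, p, hp, hpe, -⟩ := hsplit i ((hR i).1 hi)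
    rw [← hpe]
    exact (edges_of_path_instB h p hp hne).1
  have hsumR : ∑ i ∈ R, lengthOf instLen {ε | ε ∈ (f i).2.2.edges} = ∑ i ∈ R, 3 := by
    rw [Finset.sum_const, hRcard, smul_eq_mul, mul_comm]
    have h1 := hf.lengthOf_eq instLen
    rw [← Finset.sum_sdiff (Finset.subset_univ (Finset.univ.image ι)),
      Finset.sum_image hιinj.injOn, Finset.sum_congr rfl fun v _ => congrArg _ (hιe v)] at h1
    have h2 := sum_length_spineEdges G σ fs sn S
    change _ = ∑ i ∈ R, _ + _ at h1
    omega
  have hhop (i : Fin k) (hi : i ∈ R) : ∃ e ∈ G.edgeSet, ∃ u ∈ e, ∃ l,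
      Sum.inr (e, l) ∈ (f i).2.2.support ∧
        {ε | ε ∈ (f i).2.2.edges} = hopEdges σ fs e u := by
    have h3 := (Finset.sum_eq_sum_iff_of_le hge).1 hsumR.symm i hi
    obtain ⟨x, x', hne, he, p, hp, hpe, hsupp⟩ := hsplit i ((hR i).1 hi)
    rw [← hpe] at h3 ⊢
    obtain ⟨u, hu, hedges⟩ := (edges_of_path_instB h p hp hne).2 h3.symm
    exact ⟨x.1, he, u, hu, x.2, hsupp, hedges⟩
  have hchoice (e : Sym2 V) : ∃ u, e ∈ G.edgeSet → (u ∈ e ∧ u ∉ S) ∧ ∃ i,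
      (∀ l, Sum.inr (e, l) ∈ (f i).2.2.support) ∧
        {ε | ε ∈ (f i).2.2.edges} = hopEdges σ fs e u := by
    by_cases he : e ∈ G.edgeSet
    swap
    · exact ⟨fs e, fun he' => absurd he' he⟩
    have heT : (Sum.inr (e, 0) : IVert V) ∈ instA V ∪ instB G :=
      Finset.mem_union_right _ (mem_instB.2 ⟨e, he, 0, rfl⟩)
    obtain ⟨i, hi⟩ := hf.2.2.2.2.1 _ heT
    have hsupp : Sum.inr (e, 0) ∈ (f i).2.2.support := by
      rcases hi with hi | hi <;> rw [hi]
      exacts [SimpleGraph.Walk.start_mem_support _, SimpleGraph.Walk.end_mem_support _]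
    have hiR : i ∈ R := (hR i).2 fun v hv => by
      have := hend v _ (hv ▸ hsupp) heT
      simp at this
    obtain ⟨e', he', u, hu, l, hl, hedges⟩ := hhop i hiR
    have hmem {ε : Sym2 (IVert V)} (hε : ε ∈ hopEdges σ fs e' u) {x : IVert V} (hx : x ∈ ε) :
        x ∈ (f i).2.2.support := by
      rw [← hedges] at hε
      exact SimpleGraph.Walk.mem_support_of_mem_edges hε hx
    have hw (l : Fin 2) : Sum.inr (e', l) ∈ (f i).2.2.support := by
      obtain rfl | rfl : l = 0 ∨ l = 1 := by omega
      · exact hmem (Or.inl rfl) (Sym2.mem_mk_left _ _)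
      · exact hmem (Or.inr (Or.inr rfl)) (Sym2.mem_mk_right _ _)
    obtain rfl : e = e' := by
      have h0 := hf.eq_endpoint (hw 0)
        (Finset.mem_union_right _ (mem_instB.2 ⟨e', he', 0, rfl⟩))
      have h1 := hf.eq_endpoint (hw 1)
        (Finset.mem_union_right _ (mem_instB.2 ⟨e', he', 1, rfl⟩))
      have h01 : (Sum.inr (e', 0) : IVert V) ≠ Sum.inr (e', 1) := by simp
      have : (Sum.inr (e, 0) : IVert V) = Sum.inr (e', 0) ∨
          (Sum.inr (e, 0) : IVert V) = Sum.inr (e', 1) := by grind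
      simpa using this
    refine ⟨u, fun _ => ⟨⟨hu, fun huS => ?_⟩, i, hw, hedges⟩⟩
    obtain ⟨m, hm, -, ha⟩ := h.attach_spec he hu
    refine (hR i).1 hiR u (hf.index_unique (x := Sum.inl (u, attach σ fs e u 0)) ?_
      (hmem (Or.inl rfl) (Sym2.mem_mk_right _ _)))
    have hlong : s((Sum.inl (u, attach σ fs e u 0) : IVert V),
        Sum.inl (u, attach σ fs e u 0 + 1)) ∈ {ε | ε ∈ (f (ι u)).2.2.edges} := by
      rw [hιe u, spineEdges, if_pos huS]
      exact ⟨_, by omega, rfl⟩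
    exact SimpleGraph.Walk.fst_mem_support_of_mem_edges _ hlong
  choose c hc using hchoice
  refine ⟨c, fun e he => (hc e he).1, ?_⟩
  rw [hf.2.2.2.2.2, routedEdges]
  apply Set.Subset.antisymm
  · refine Set.iUnion_subset fun i => ?_
    by_cases hi : i ∈ R
    · obtain ⟨e, he, u, hu, l, hl, hedges⟩ := hhop i hi
      obtain ⟨-, j, hj, hjedges⟩ := hc e he
      obtain rfl := hf.index_unique hl (hj l)
      rw [hjedges]
      exact Set.subset_union_of_subset_right
        (Set.subset_biUnion_of_mem (u := fun e => hopEdges σ fs e (c e)) he) _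
    · simp only [hR, not_forall, not_not] at hi
      obtain ⟨v, rfl⟩ := hi
      rw [hιe v]
      exact Set.subset_union_of_subset_left (Set.subset_iUnion _ v) _
  · refine Set.union_subset (Set.iUnion_subset fun v => ?_) (Set.iUnion₂_subset fun e he => ?_)
    · rw [← hιe v]
      exact Set.subset_iUnion (fun i => {ε | ε ∈ (f i).2.2.edges}) _
    · obtain ⟨-, j, -, hj⟩ := hc e he
      rw [← hj]
      exact Set.subset_iUnion (fun i => {ε | ε ∈ (f i).2.2.edges}) _

/-- The edges of `G` with no endpoint in `S`. -/
def freeEdges (G : SimpleGraph V) [DecidableRel G.Adj] (S : Finset V) : Finset (Sym2 V) :=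
  G.edgeFinset \ S.biUnion fun v => G.incidenceFinset v

lemma card_freeEdges (hcubic : ∀ v : V, G.degree v = 3) {S : Finset V}
    (hS : ∀ u ∈ S, ∀ w ∈ S, ¬ G.Adj u w) :
    (freeEdges G S).card = G.edgeFinset.card - 3 * S.card := by
  rw [freeEdges, Finset.card_sdiff_of_subset, Finset.card_biUnion]
  · simp [hcubic, mul_comm]
  · intro u hu w hw huw
    refine Finset.disjoint_left.2 fun e heu hew => ?_
    rw [SimpleGraph.mem_incidenceFinset] at heu hew
    exact hS u hu w hw (G.adj_of_mem_incidenceSet huw heu hew)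
  · refine Finset.biUnion_subset.2 fun v _ e he => ?_
    rw [SimpleGraph.mem_incidenceFinset] at he
    exact SimpleGraph.mem_edgeFinset.2 he.1

lemma mem_freeEdges (h : IsAdmissible G σ fs sn) {S : Finset V} {e : Sym2 V} :
    e ∈ freeEdges G S ↔ e ∈ G.edgeSet ∧ fs e ∉ S ∧ sn e ∉ S := by
  simp only [freeEdges, Finset.mem_sdiff, SimpleGraph.mem_edgeFinset, Finset.mem_biUnion,
    SimpleGraph.mem_incidenceFinset, SimpleGraph.incidenceSet, Set.mem_ofPred_eq, not_exists,
    not_and]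
  refine and_congr_right fun he => ⟨fun hv => ⟨fun hS => ?_, fun hS => ?_⟩, ?_⟩
  · exact hv _ hS he ((h.mem_iff he).2 (Or.inl rfl))
  · exact hv _ hS he ((h.mem_iff he).2 (Or.inr rfl))
  · rintro ⟨h1, h2⟩ v hv - hve
    rcases (h.mem_iff he).1 hve with rfl | rfl <;> contradiction

lemma ncard_routedEdges (h : IsAdmissible G σ fs sn) {S : Finset V}
    (hS : ∀ u ∈ S, ∀ w ∈ S, ¬ G.Adj u w) :
    {E' | ∃ c, IsRouting G S c ∧ E' = routedEdges G σ fs S c}.ncard =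
      2 ^ (freeEdges G S).card := by
  have himage : {E' | ∃ c, IsRouting G S c ∧ E' = routedEdges G σ fs S c} =
      (fun T => routedEdges G σ fs S (routeBy fs sn S T)) '' (freeEdges G S).powerset := by
    ext E'
    constructor
    · rintro ⟨c, hc, rfl⟩
      refine ⟨(freeEdges G S).filter fun e => c e = fs e,
        Finset.mem_coe.2 (Finset.mem_powerset.2 (Finset.filter_subset _ _)), ?_⟩
      refine routedEdges_congr fun e he => ?_
      obtain ⟨hce, hcS⟩ := hc e he
      rw [h.mem_iff he] at hce
      have hne := h.fs_ne_sn he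
      simp only [routeBy, Finset.mem_filter, mem_freeEdges h, he, true_and]
      grind
    · rintro ⟨T, -, rfl⟩
      exact ⟨_, isRouting_routeBy h hS T, rfl⟩
  rw [himage, Set.InjOn.ncard_image, Set.ncard_coe_finset, Finset.card_powerset]
  intro T hT T' hT' hTT
  rw [Finset.mem_coe, Finset.mem_powerset] at hT hT'
  have hiff {e : Sym2 V} (he : e ∈ freeEdges G S) : e ∈ T ↔ e ∈ T' := by
    obtain ⟨he, h1, h2⟩ := (mem_freeEdges h).1 he
    have heq := eq_of_routedEdges_eq hTT he
    have hne := h.fs_ne_sn he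
    simp only [routeBy, if_neg h1, if_neg h2] at heq
    grind
  ext e
  exact ⟨fun he => (hiff (hT he)).1 he, fun he => (hiff (hT' he)).2 he⟩

end Solutions

end Instance

/-!
STATEMENT 11.  For every independent set `S` of `G` there is a solution to Disjoint
`A`,`B`-paths on the instance `I` of length `12|V| + 3|E| − |S|`.  Moreover, for every
maximum independent set `S` of `G`, the number of solutions of length
`12|V| + 3|E| − α(G)` in which, for each `v ∈ V`, the vertices `v′₁` and `v′₈` are
joined by the path `v′₁v′₂⋯v′₈` precisely when `v ∈ S`, equals `2^{|E| − 3α(G)}`.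
-/
theorem stmt11 {V : Type} [Fintype V] [DecidableEq V]
    (G : SimpleGraph V) [DecidableRel G.Adj]
    (hcubic : ∀ v : V, G.degree v = 3)
    (σ : V → Sym2 V → ℕ) (fs sn : Sym2 V → V)
    (hfssn : ∀ e ∈ G.edgeSet, e = s(fs e, sn e))
    (hσmem : ∀ v : V, ∀ e ∈ G.incidenceSet v, σ v e = 2 ∨ σ v e = 4 ∨ σ v e = 6)
    (hσinj : ∀ v : V, Set.InjOn (σ v) (G.incidenceSet v)) :
    (∀ S : Finset V, (∀ u ∈ S, ∀ w ∈ S, ¬ G.Adj u w) →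
      ∃ E', IsSolution (instGraph G σ fs sn) (instA V) (instB G) E' ∧
        lengthOf instLen E' =
          12 * Fintype.card V + 3 * G.edgeFinset.card - S.card) ∧
    (∀ S : Finset V, (∀ u ∈ S, ∀ w ∈ S, ¬ G.Adj u w) → S.card = indepNum G →
      Set.ncard {E' : Set (Sym2 (IVert V)) |
          IsSolution (instGraph G σ fs sn) (instA V) (instB G) E' ∧
          lengthOf instLen E' =
            12 * Fintype.card V + 3 * G.edgeFinset.card - indepNum G ∧
          ∃ (k : ℕ)
            (f : Fin k → (u : IVert V) × (w : IVert V) × (instGraph G σ fs sn).Walk u w),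
            IsPathFamily (instGraph G σ fs sn) (instA V) (instB G) E' f ∧
            ∀ v : V, (v ∈ S ↔ ∃ i, {e | e ∈ (f i).2.2.edges} = longPathEdges v)} =
        2 ^ (G.edgeFinset.card - 3 * indepNum G)) := by
  have h : IsAdmissible G σ fs sn := ⟨hfssn, hσmem, hσinj⟩
  refine ⟨fun S hS => ?_, fun S hS hα => ?_⟩
  · obtain ⟨k, f, hf, -, hlen⟩ := (isRouting_routeBy h hS ∅).exists_family h
    exact ⟨_, ⟨k, f, hf⟩, by omega⟩
  · rw [← hα, ← card_freeEdges hcubic hS, ← ncard_routedEdges h hS]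
    congr 1
    ext E'
    constructor
    · rintro ⟨-, hlen, k, f, hf, hfS⟩
      refine hf.eq_routedEdges h hfS ?_
      have := Finset.card_le_univ S
      omega
    · rintro ⟨c, hc, rfl⟩
      obtain ⟨k, f, hf, hfS, hlen⟩ := hc.exists_family h
      exact ⟨⟨k, f, hf⟩, by omega, k, f, hf, hfS⟩
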